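/- arXiv:1303.5188 — 2 statements merged into one kernel-verified Lean document; each statement's English description precedes it below -/
import Mathlib

section
/- For every group homomorphism φ : N_{m+1} → ℂ^× with φ|_{K_{m+1}} = φ_{A₀} and every group homomorphism μ : (ℤ/p^lℤ)^× → ℂ^×, one has Σ_{X ∈ N_{m+1}} μ(det X)·φ(X)·e(Tr X) = 0. (Intermediate vanishing claim in the proof of Theorem 3.5.) -/
noncomputable section
open Matrix Complex

/-- The additive character `x ↦ ζ_N^{r·x} = exp(2πi·r·x/N)` of `ZMod N`. -/
def aChar (N : ℕ) (r : ℤ) (x : ZMod N) : ℂ :=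
  Complex.exp (2 * Real.pi * Complex.I * (r : ℂ) * (x.val : ℂ) / (N : ℂ))

/-- The congruence set `K_k = {I + p^k B}` inside `GL₂(ℤ/p^l)`. -/
def Kset (p l k : ℕ) : Set (GL (Fin 2) (ZMod (p ^ l))) :=
  {X | ∃ B : Matrix (Fin 2) (Fin 2) (ZMod (p ^ l)),
        X.val = 1 + ((p : ZMod (p ^ l)) ^ k) • B}

/-- `N_{m+1} = {[[a, pεb+p^{m+1}c],[pb, a+p^{m+1}d]]} ∩ GL₂(ℤ/p^l)`. -/
def NsetOdd (p l ε m : ℕ) : Set (GL (Fin 2) (ZMod (p ^ l))) :=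
  {X | ∃ a b c d : ZMod (p ^ l),
    X.val = !![a, (p : ZMod (p ^ l)) * (ε : ZMod (p ^ l)) * b + (p : ZMod (p ^ l)) ^ (m + 1) * c;
               (p : ZMod (p ^ l)) * b, a + (p : ZMod (p ^ l)) ^ (m + 1) * d]}

/-- `φ_A(X) = λ(Tr(A(X−I)))` with `λ = aChar (p^l) 1`. -/
def phiA (p l : ℕ) (A : Matrix (Fin 2) (Fin 2) (ZMod (p ^ l)))
    (X : GL (Fin 2) (ZMod (p ^ l))) : ℂ :=
  aChar (p ^ l) 1 (Matrix.trace (A * (X.val - 1)))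

theorem aChar_eq_stdAddChar (N : ℕ) [NeZero N] (r : ℤ) (x : ZMod N) :
    aChar N r x = ZMod.stdAddChar ((r : ZMod N) * x) := by
  have h : (r : ZMod N) * x = ((r * (x.val : ℤ) : ℤ) : ZMod N) := by
    push_cast
    rw [ZMod.natCast_zmod_val]
  rw [h, ZMod.stdAddChar_coe, aChar]
  push_cast
  ring_nf

/-- A sum over a finite group vanishes if right translation by `k` multiplies the summand by a
`k`-invariant factor that is nowhere `1`. -/
theorem sum_eq_zero_of_translate {G : Type*} [Group G] [Fintype G] (f w : G → ℂ) (k : G)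
    (hf : ∀ x, f (x * k) = f x * w x) (hw : ∀ x, w (x * k) = w x)
    (hne : ∀ x, f x ≠ 0 → w x ≠ 1) : ∑ x, f x = 0 := by
  have h : ∀ x, f x = f x / (1 - w x) - f (x * k) / (1 - w (x * k)) := by
    intro x
    rw [hf, hw]
    by_cases h0 : f x = 0
    · simp [h0]
    · have : 1 - w x ≠ 0 := sub_ne_zero.mpr (hne x h0).symm
      field_simp
  rw [Finset.sum_congr rfl fun x _ => h x, Finset.sum_sub_distrib, sub_eq_zero]
  exact (Equiv.sum_comp (Equiv.mulRight k) fun x => f x / (1 - w x)).symm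

/-- The upper unitriangular matrix `[[1, t], [0, 1]]`. -/
def upperUnipotent {R : Type*} [CommRing R] (t : R) : GL (Fin 2) R where
  val := !![1, t; 0, 1]
  inv := !![1, -t; 0, 1]
  val_inv := by simp [Matrix.one_fin_two]
  inv_val := by simp [Matrix.one_fin_two]

theorem upperUnipotent_inv {R : Type*} [CommRing R] (t : R) :
    (upperUnipotent t)⁻¹ = upperUnipotent (-t) :=
  Units.ext rfl

theorem mul_upperUnipotent_val {R : Type*} [CommRing R] (X : GL (Fin 2) R) (t : R) :
    (X * upperUnipotent t).val =
      !![X.val 0 0, X.val 0 0 * t + X.val 0 1; X.val 1 0, X.val 1 0 * t + X.val 1 1] := by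
  rw [Units.val_mul]
  conv_lhs => rw [Matrix.eta_fin_two X.val]
  simp [upperUnipotent]

theorem upperUnipotent_mem_Kset (p l k : ℕ) (t : ZMod (p ^ l)) :
    upperUnipotent ((p : ZMod (p ^ l)) ^ k * t) ∈ Kset p l k := by
  refine ⟨!![0, t; 0, 0], ?_⟩
  simp [upperUnipotent, Matrix.one_fin_two]

theorem upperUnipotent_mem_NsetOdd (p l ε m : ℕ) (t : ZMod (p ^ l)) :
    upperUnipotent ((p : ZMod (p ^ l)) ^ (m + 1) * t) ∈ NsetOdd p l ε m :=
  ⟨1, 0, t, 0, by simp [upperUnipotent]⟩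

theorem mul_upperUnipotent_mem_NsetOdd {p l ε m : ℕ} {X : GL (Fin 2) (ZMod (p ^ l))}
    (hX : X ∈ NsetOdd p l ε m) (t : ZMod (p ^ l)) :
    X * upperUnipotent ((p : ZMod (p ^ l)) ^ (m + 1) * t) ∈ NsetOdd p l ε m := by
  obtain ⟨a, b, c, d, h⟩ := hX
  refine ⟨a, b, c + a * t, d + p * b * t, ?_⟩
  rw [mul_upperUnipotent_val, h]
  ext i j
  fin_cases i <;> fin_cases j <;> simp <;> ring

theorem mul_upperUnipotent_mem_NsetOdd_iff {p l ε m : ℕ} {X : GL (Fin 2) (ZMod (p ^ l))}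
    (t : ZMod (p ^ l)) :
    X * upperUnipotent ((p : ZMod (p ^ l)) ^ (m + 1) * t) ∈ NsetOdd p l ε m ↔
      X ∈ NsetOdd p l ε m := by
  refine ⟨fun h => ?_, fun h => mul_upperUnipotent_mem_NsetOdd h t⟩
  have h' := mul_upperUnipotent_mem_NsetOdd h (-t)
  rwa [mul_neg, ← upperUnipotent_inv, mul_inv_cancel_right] at h'

theorem ZMod.prime_pow_mul_ne_zero (p l k : ℕ) [Fact p.Prime] (hk : k < l) (c : ZMod (p ^ l)) :
    (p : ZMod (p ^ l)) ^ k * (1 + p * c) ≠ 0 := by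
  have hnil : IsNilpotent ((p : ZMod (p ^ l)) * c) :=
    ⟨l, by rw [mul_pow, ← Nat.cast_pow, ZMod.natCast_self, zero_mul]⟩
  rw [Ne, hnil.isUnit_one_add.mul_left_eq_zero, ← Nat.cast_pow, ZMod.natCast_eq_zero_iff,
    Nat.pow_dvd_pow_iff_le_right (Fact.out : p.Prime).one_lt]
  exact hk.not_ge


/-- Intermediate vanishing claim in the proof of Theorem 3.5: for `l = 2m+1` odd,
every character `φ` of `N_{m+1}` with `φ|_{K_{m+1}} = φ_{A₀}` and every character `μ`
of `(ℤ/p^l)^×` satisfy `Σ_{X ∈ N_{m+1}} μ(det X)·φ(X)·e(Tr X) = 0`. -/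
theorem thm_3_5_intermediate_vanishing (p m : ℕ) [Fact p.Prime] (hp : Odd p) (hm : 1 ≤ m)
    (r : ℤ) (hr : ¬ ((p : ℤ) ^ (2 * m + 1) ∣ r))
    (ε : ℕ) (hε : ε < p ^ m) (hres : ¬ IsSquare (ε : ZMod p))
    (μ : ZMod (p ^ (2 * m + 1)) → ℂ)
    (hμmul : ∀ x y : ZMod (p ^ (2 * m + 1)), IsUnit x → IsUnit y → μ (x * y) = μ x * μ y)
    (hμne : ∀ x : ZMod (p ^ (2 * m + 1)), IsUnit x → μ x ≠ 0)
    (φ : GL (Fin 2) (ZMod (p ^ (2 * m + 1))) → ℂ)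
    (hφmul : ∀ X Y : GL (Fin 2) (ZMod (p ^ (2 * m + 1))),
      X ∈ NsetOdd p (2 * m + 1) ε m → Y ∈ NsetOdd p (2 * m + 1) ε m →
        φ (X * Y) = φ X * φ Y)
    (hφne : ∀ X ∈ NsetOdd p (2 * m + 1) ε m, φ X ≠ 0)
    (hφK : ∀ X ∈ Kset p (2 * m + 1) (m + 1),
      φ X = phiA p (2 * m + 1)
        !![(0 : ZMod (p ^ (2 * m + 1))), (ε : ZMod (p ^ (2 * m + 1))); 1, 0] X) :
    ∑ X : GL (Fin 2) (ZMod (p ^ (2 * m + 1))),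
      (NsetOdd p (2 * m + 1) ε m).indicator
        (fun Y => μ Y.val.det * φ Y * aChar (p ^ (2 * m + 1)) r (Matrix.trace Y.val)) X
      = 0 := by
  have hp0 : NeZero (p ^ (2 * m + 1)) := ⟨pow_ne_zero _ (Fact.out : p.Prime).ne_zero⟩
  set q : ZMod (p ^ (2 * m + 1)) := (p : ZMod (p ^ (2 * m + 1))) ^ (m + 1) * 1 with hq
  have hφk : φ (upperUnipotent q) = ZMod.stdAddChar q := by
    rw [hφK _ (upperUnipotent_mem_Kset p _ _ 1), phiA, aChar_eq_stdAddChar, ← hq]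
    simp [upperUnipotent, Matrix.one_fin_two, Matrix.trace_fin_two]
  have hval : ∀ X : GL (Fin 2) (ZMod (p ^ (2 * m + 1))), (X * upperUnipotent q).val =
      !![X.val 0 0, X.val 0 0 * q + X.val 0 1; X.val 1 0, X.val 1 0 * q + X.val 1 1] :=
    fun X => mul_upperUnipotent_val X q
  refine sum_eq_zero_of_translate _
    (fun X => ZMod.stdAddChar (q * (1 + (r : ZMod (p ^ (2 * m + 1))) * X.val 1 0))) (upperUnipotent q) ?_ ?_ ?_
  · intro X
    by_cases hX : X ∈ NsetOdd p (2 * m + 1) ε m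
    · have hdet : (X * upperUnipotent q).val.det = X.val.det := by
        rw [Units.val_mul, Matrix.det_mul]
        simp [upperUnipotent, Matrix.det_fin_two]
      have htr : (X * upperUnipotent q).val.trace = X.val.trace + q * X.val 1 0 := by
        rw [hval]
        simp only [Matrix.trace_fin_two, Matrix.of_apply, Matrix.cons_val', Matrix.cons_val_zero,
          Matrix.cons_val_one, Matrix.cons_val_fin_one]
        ring
      rw [Set.indicator_of_mem hX, Set.indicator_of_mem
        ((mul_upperUnipotent_mem_NsetOdd_iff 1).mpr hX), hdet, htr,
        hφmul _ _ hX (upperUnipotent_mem_NsetOdd p _ ε m 1), hφk, aChar_eq_stdAddChar,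
        aChar_eq_stdAddChar, mul_add, mul_add, mul_one, AddChar.map_add_eq_mul,
        AddChar.map_add_eq_mul, mul_left_comm q]
      ring
    · rw [Set.indicator_of_notMem hX, Set.indicator_of_notMem
        (fun h => hX ((mul_upperUnipotent_mem_NsetOdd_iff 1).mp h)), zero_mul]
  · intro X
    simp [hval]
  · intro X hX
    obtain ⟨a, b, c, d, h⟩ := Set.mem_of_indicator_ne_zero hX
    rw [← AddChar.map_zero_eq_one (ZMod.stdAddChar (N := p ^ (2 * m + 1)))]
    refine ZMod.injective_stdAddChar.ne ?_
    have hne := ZMod.prime_pow_mul_ne_zero p (2 * m + 1) (m + 1) (by omega) (r * b)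
    simpa [h, hq, mul_left_comm] using hne
end
end

section
/- If p ∤ r, then with M = [[−αr⁻¹, −εr⁻¹],[−r⁻¹, −αr⁻¹]] ∈ S one has τ_l(χ_φ) = −p^l · χ_φ(I) · Σ_{Y ∈ (K_m∩S)·M} μ(det Y)·e(Tr Y)·φ(Y), where χ_φ = (μ∘det)·((1/p)·Ind_{N_{m+1}}^{G_l}(φ|_{N_{m+1}}) − Ind_{L}^{G_l} φ) and (K_m∩S)·M = {ZM : Z ∈ K_m∩S} ⊆ S. (Theorem 3.5(2): Gauss sums for the degree-p^{l−1}(p−1) characters of G_l, l odd, when p does not divide r.) -/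
noncomputable section
open Matrix Complex

/-- The Gauss sum `τ_l(χ) = Σ_{X ∈ GL₂(ℤ/N)} χ(X) e(Tr X)` with `e = aChar N r`. -/
def tauGL (N : ℕ) [NeZero N] (r : ℤ) (χ : GL (Fin 2) (ZMod N) → ℂ) : ℂ :=
  ∑ X : GL (Fin 2) (ZMod N), χ X * aChar N r (Matrix.trace X.val)

/-- `(Ind_H^T ψ)(g) = |H|⁻¹ Σ_{x ∈ T, x g x⁻¹ ∈ H} ψ(x g x⁻¹)`; induction to the
full group is the case `T = Set.univ`. -/
def indC (N : ℕ) [NeZero N] (H T : Set (GL (Fin 2) (ZMod N)))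
    (ψ : GL (Fin 2) (ZMod N) → ℂ) (g : GL (Fin 2) (ZMod N)) : ℂ :=
  (Nat.card H : ℂ)⁻¹ *
    ∑ x : GL (Fin 2) (ZMod N), T.indicator (fun y => H.indicator ψ (y * g * y⁻¹)) x

/-- `S = {[[a, εb],[b, a]]} ∩ GL₂(ℤ/p^l)`. -/
def Sset (p l ε : ℕ) : Set (GL (Fin 2) (ZMod (p ^ l))) :=
  {X | ∃ a b : ZMod (p ^ l), X.val = !![a, (ε : ZMod (p ^ l)) * b; b, a]}

/-- `K_k · S`. -/
def TKS (p l ε k : ℕ) : Set (GL (Fin 2) (ZMod (p ^ l))) :=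
  {X | ∃ Y ∈ Kset p l k, ∃ Z ∈ Sset p l ε, X = Y * Z}

section PrimePower

variable {p : ℕ} [Fact p.Prime]

theorem primePow_mul_eq_zero_iff {a b l : ℕ} (h : a + b = l) (x : ZMod (p ^ l)) :
    (p : ZMod (p ^ l)) ^ a * x = 0 ↔ (p : ZMod (p ^ l)) ^ b ∣ x := by
  have hp : 0 < p := (Fact.out : p.Prime).pos
  subst h
  constructor
  · intro hx
    obtain ⟨n, rfl⟩ := ZMod.natCast_zmod_surjective x
    rw [← Nat.cast_pow, ← Nat.cast_mul, ZMod.natCast_eq_zero_iff, pow_add] at hx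
    obtain ⟨c, rfl⟩ := Nat.dvd_of_mul_dvd_mul_left (pow_pos hp a) hx
    exact ⟨c, by push_cast; ring⟩
  · rintro ⟨y, rfl⟩
    rw [← mul_assoc, ← pow_add, ← Nat.cast_pow, ZMod.natCast_self, zero_mul]

theorem ncard_primePow_dvd {a b l : ℕ} (h : a + b = l) :
    {x : ZMod (p ^ l) | (p : ZMod (p ^ l)) ^ b ∣ x}.ncard = p ^ a := by
  have hp : 0 < p := (Fact.out : p.Prime).pos
  subst h
  have himg : {x : ZMod (p ^ (a + b)) | (p : ZMod (p ^ (a + b))) ^ b ∣ x} =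
      (fun n : ℕ => ((p ^ b * n : ℕ) : ZMod (p ^ (a + b)))) '' (Finset.range (p ^ a) : Set ℕ) := by
    ext x
    constructor
    · rintro ⟨y, rfl⟩
      obtain ⟨n, rfl⟩ := ZMod.natCast_zmod_surjective y
      refine ⟨n % p ^ a, by simpa using Nat.mod_lt _ (pow_pos hp a), ?_⟩
      have : (p : ZMod (p ^ (a + b))) ^ b * (n : ZMod (p ^ (a + b))) =
          ((p ^ b * n : ℕ) : ZMod (p ^ (a + b))) := by push_cast; rfl
      rw [this]
      refine (ZMod.natCast_eq_natCast_iff _ _ _).2 ?_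
      rw [pow_add, mul_comm (p ^ a)]
      exact (Nat.mod_modEq n (p ^ a)).mul_left' _
    · rintro ⟨n, -, rfl⟩
      exact ⟨n, by push_cast; rfl⟩
  rw [himg, Set.InjOn.ncard_image, Set.ncard_coe_finset, Finset.card_range]
  intro n hn k hk hnk
  simp only [Finset.coe_range, Set.mem_Iio] at hn hk
  have hnk' := (ZMod.natCast_eq_natCast_iff _ _ _).1 hnk
  rw [pow_add, mul_comm (p ^ a)] at hnk'
  exact (Nat.ModEq.mul_left_cancel' (pow_pos hp b).ne' hnk').eq_of_lt_of_lt hn hk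

theorem isUnit_iff_castHom_ne_zero {l : ℕ} (hl : l ≠ 0) (x : ZMod (p ^ l)) :
    IsUnit x ↔ ZMod.castHom (dvd_pow_self p hl) (ZMod p) x ≠ 0 := by
  obtain ⟨n, rfl⟩ := ZMod.natCast_zmod_surjective x
  rw [ZMod.isUnit_iff_coprime, map_natCast, Ne, ZMod.natCast_eq_zero_iff,
    Nat.coprime_pow_right_iff (Nat.pos_of_ne_zero hl), Nat.coprime_comm,
    (Fact.out : p.Prime).coprime_iff_not_dvd]

theorem castHom_eq_zero_iff_dvd {l : ℕ} (hl : l ≠ 0) (x : ZMod (p ^ l)) :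
    ZMod.castHom (dvd_pow_self p hl) (ZMod p) x = 0 ↔ (p : ZMod (p ^ l)) ∣ x := by
  constructor
  · intro h
    obtain ⟨n, rfl⟩ := ZMod.natCast_zmod_surjective x
    rw [map_natCast, ZMod.natCast_eq_zero_iff] at h
    obtain ⟨c, rfl⟩ := h
    exact ⟨c, by push_cast; rfl⟩
  · rintro ⟨y, rfl⟩
    rw [map_mul, map_natCast, CharP.cast_eq_zero, zero_mul]

theorem isUnit_intCast_of_not_dvd {l : ℕ} {r : ℤ} (hr : ¬ (p : ℤ) ∣ r) :
    IsUnit (r : ZMod (p ^ l)) := by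
  have h : IsCoprime (p ^ l : ℤ) r :=
    ((Nat.prime_iff_prime_int.1 Fact.out).irreducible.coprime_iff_not_dvd.2 hr).pow_left
  have h' := h.map (Int.castRingHom (ZMod (p ^ l)))
  have h0 : Int.castRingHom (ZMod (p ^ l)) ((p : ℤ) ^ l) = 0 := by
    have := ZMod.natCast_self (p ^ l)
    push_cast at this
    simpa using this
  rw [h0] at h'
  exact isCoprime_zero_left.1 h'

end PrimePower

theorem sum_stdAddChar_trace_mul {n : Type*} [Fintype n] [DecidableEq n] {N : ℕ} [NeZero N]
    (C : Matrix n n (ZMod N)) :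
    ∑ B : Matrix n n (ZMod N), ZMod.stdAddChar (C * B).trace =
      if C = 0 then (Fintype.card (Matrix n n (ZMod N)) : ℂ) else 0 := by
  split_ifs with hC
  · simp [hC]
  · let f : AddChar (Matrix n n (ZMod N)) ℂ := ZMod.stdAddChar.compAddMonoidHom
      ((Matrix.traceAddMonoidHom n (ZMod N)).comp (AddMonoidHom.mulLeft C))
    have hf : f ≠ 0 := by
      obtain ⟨i, j, hij⟩ : ∃ i j, C i j ≠ 0 := by
        by_contra! h
        exact hC (Matrix.ext h)
      obtain ⟨y, hy⟩ := AddChar.ne_one_iff.1 (ZMod.isPrimitive_stdAddChar N hij)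
      refine AddChar.ne_zero_iff.2 ⟨Matrix.single j i y, ?_⟩
      simpa [f, Matrix.trace_mul_single, AddChar.mulShift_apply] using hy
    exact AddChar.sum_eq_zero_iff_ne_zero.2 hf

section Induced

variable {N : ℕ} [NeZero N]

theorem sum_classFunction_mul_indC (H : Set (GL (Fin 2) (ZMod N)))
    (f ψ : GL (Fin 2) (ZMod N) → ℂ) (hf : ∀ x y, f (y * x * y⁻¹) = f x) :
    ∑ X, f X * indC N H Set.univ ψ X =
      Nat.card (GL (Fin 2) (ZMod N)) * (Nat.card H : ℂ)⁻¹ *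
        ∑ Y, H.indicator (fun Y => f Y * ψ Y) Y := by
  have key (y : GL (Fin 2) (ZMod N)) :
      ∑ X, f X * H.indicator ψ (y * X * y⁻¹) = ∑ Y, H.indicator (fun Y => f Y * ψ Y) Y := by
    rw [← Equiv.sum_comp (MulAut.conj y).toEquiv (H.indicator fun Y => f Y * ψ Y)]
    refine Finset.sum_congr rfl fun X _ => ?_
    by_cases h : y * X * y⁻¹ ∈ H <;> simp [h, hf]
  simp only [indC, Set.indicator_univ, Finset.mul_sum]
  rw [Finset.sum_comm]
  simp_rw [mul_left_comm _ (Nat.card H : ℂ)⁻¹, ← Finset.mul_sum, key]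
  simp
  ring

theorem indC_one {H : Set (GL (Fin 2) (ZMod N))} (h1 : 1 ∈ H) (ψ : GL (Fin 2) (ZMod N) → ℂ) :
    indC N H Set.univ ψ 1 =
      Nat.card (GL (Fin 2) (ZMod N)) * (Nat.card H : ℂ)⁻¹ * ψ 1 := by
  simp [indC, h1]
  ring

end Induced

section SquareZero

variable {R : Type*} [CommRing R]

/-- The invertible matrix `1 + P • B`, where `P ^ 2 = 0`. -/
def oneAddSMul (P : R) (hP : P * P = 0) (B : Matrix (Fin 2) (Fin 2) R) : GL (Fin 2) R where
  val := 1 + P • B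
  inv := 1 - P • B
  val_inv := by simp [mul_sub, add_mul, smul_smul, hP]
  inv_val := by simp [mul_add, sub_mul, smul_sub, smul_smul, hP]

variable {P : R} {hP : P * P = 0}

@[simp] theorem val_oneAddSMul (B : Matrix (Fin 2) (Fin 2) R) :
    (oneAddSMul P hP B).val = 1 + P • B := rfl

theorem oneAddSMul_mul (B C : Matrix (Fin 2) (Fin 2) R) :
    oneAddSMul P hP B * oneAddSMul P hP C = oneAddSMul P hP (B + C) := by
  ext1
  simp [mul_add, add_mul, smul_smul, hP, add_assoc, add_comm, add_left_comm]

theorem det_oneAddSMul (B : Matrix (Fin 2) (Fin 2) R) :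
    (oneAddSMul P hP B).val.det = 1 + P * B.trace := by
  simp [Matrix.det_fin_two, Matrix.trace_fin_two]
  linear_combination (B 0 0 * B 1 1 - B 0 1 * B 1 0) * hP

theorem one_add_pow_of_sq_zero (hP : P * P = 0) (n : ℕ) : (1 + P) ^ n = 1 + P * n := by
  induction n with
  | zero => simp
  | succ n ih =>
    rw [pow_succ, ih]
    push_cast
    linear_combination (n : R) * hP

end SquareZero

section CongruenceSets

theorem mem_Sset_iff {p l ε : ℕ} {X : GL (Fin 2) (ZMod (p ^ l))} :
    X ∈ Sset p l ε ↔ Commute X.val !![0, (ε : ZMod (p ^ l)); 1, 0] := by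
  have hX := Matrix.eta_fin_two X.val
  constructor
  · rintro ⟨a, b, h⟩
    rw [h, Commute, SemiconjBy]
    ext i j
    fin_cases i <;> fin_cases j <;> simp [Matrix.mul_apply, Fin.sum_univ_two, mul_comm]
  · intro h
    rw [Commute, SemiconjBy, hX, Matrix.mul_fin_two, Matrix.mul_fin_two] at h
    have h0 := congrFun (congrFun h 0) 0
    have h1 := congrFun (congrFun h 1) 0
    simp at h0 h1
    refine ⟨X.val 0 0, X.val 1 0, ?_⟩
    nth_rewrite 1 [hX]
    rw [h0, h1]

theorem mul_mem_Sset {p l ε : ℕ} {X Y : GL (Fin 2) (ZMod (p ^ l))}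
    (hX : X ∈ Sset p l ε) (hY : Y ∈ Sset p l ε) : X * Y ∈ Sset p l ε := by
  rw [mem_Sset_iff] at *
  exact hX.mul_left hY

theorem inv_mem_Sset {p l ε : ℕ} {X : GL (Fin 2) (ZMod (p ^ l))}
    (hX : X ∈ Sset p l ε) : X⁻¹ ∈ Sset p l ε := by
  rw [mem_Sset_iff] at *
  exact hX.units_inv_left

variable {p m ε : ℕ}

theorem primePow_succ_mul_self (p m : ℕ) :
    (p : ZMod (p ^ (2 * m + 1))) ^ (m + 1) * (p : ZMod (p ^ (2 * m + 1))) ^ (m + 1) = 0 := by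
  rw [← pow_add, show m + 1 + (m + 1) = 2 * m + 1 + 1 by ring,
    pow_succ (p : ZMod (p ^ (2 * m + 1))) (2 * m + 1), ← Nat.cast_pow, ZMod.natCast_self, zero_mul]

/-- The element `1 + p ^ (m + 1) • B` of `GL₂(ℤ/p^(2m+1))`. -/
abbrev congrElt (p m : ℕ) (B : Matrix (Fin 2) (Fin 2) (ZMod (p ^ (2 * m + 1)))) :
    GL (Fin 2) (ZMod (p ^ (2 * m + 1))) :=
  oneAddSMul ((p : ZMod (p ^ (2 * m + 1))) ^ (m + 1)) (primePow_succ_mul_self p m) B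

theorem mem_Kset_succ_iff {X : GL (Fin 2) (ZMod (p ^ (2 * m + 1)))} :
    X ∈ Kset p (2 * m + 1) (m + 1) ↔ ∃ B, X = congrElt p m B := by
  simp [Kset, Units.ext_iff]

theorem mem_TKS_iff {X : GL (Fin 2) (ZMod (p ^ (2 * m + 1)))} :
    X ∈ TKS p (2 * m + 1) ε (m + 1) ↔
      ∃ B, ∃ Z ∈ Sset p (2 * m + 1) ε, X = congrElt p m B * Z := by
  constructor
  · rintro ⟨Y, hY, Z, hZ, rfl⟩
    obtain ⟨B, rfl⟩ := mem_Kset_succ_iff.1 hY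
    exact ⟨B, Z, hZ, rfl⟩
  · rintro ⟨B, Z, hZ, rfl⟩
    exact ⟨_, mem_Kset_succ_iff.2 ⟨B, rfl⟩, Z, hZ, rfl⟩

theorem congrElt_mul_mem_TKS {X : GL (Fin 2) (ZMod (p ^ (2 * m + 1)))}
    (hX : X ∈ TKS p (2 * m + 1) ε (m + 1)) (B) :
    congrElt p m B * X ∈ TKS p (2 * m + 1) ε (m + 1) := by
  obtain ⟨C, Z, hZ, rfl⟩ := mem_TKS_iff.1 hX
  exact mem_TKS_iff.2 ⟨B + C, Z, hZ, by rw [← mul_assoc, oneAddSMul_mul]⟩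

theorem congrElt_zero_mul (X : GL (Fin 2) (ZMod (p ^ (2 * m + 1)))) :
    congrElt p m 0 * X = X := by
  ext1
  simp

theorem congrElt_neg_mul (B) (X : GL (Fin 2) (ZMod (p ^ (2 * m + 1)))) :
    congrElt p m (-B) * (congrElt p m B * X) = X := by
  rw [← mul_assoc, oneAddSMul_mul, neg_add_cancel, congrElt_zero_mul]

theorem congrElt_mul_mem_TKS_iff {X : GL (Fin 2) (ZMod (p ^ (2 * m + 1)))} (B) :
    congrElt p m B * X ∈ TKS p (2 * m + 1) ε (m + 1) ↔ X ∈ TKS p (2 * m + 1) ε (m + 1) :=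
  ⟨fun h => by simpa only [congrElt_neg_mul] using congrElt_mul_mem_TKS h (-B),
    fun h => congrElt_mul_mem_TKS h B⟩

theorem one_mem_Sset {l : ℕ} : 1 ∈ Sset p l ε := mem_Sset_iff.2 (Commute.one_left _)

theorem congrElt_mem_TKS (B) : congrElt p m B ∈ TKS p (2 * m + 1) ε (m + 1) :=
  mem_TKS_iff.2 ⟨B, 1, one_mem_Sset, (mul_one _).symm⟩

theorem Sset_subset_TKS : Sset p (2 * m + 1) ε ⊆ TKS p (2 * m + 1) ε (m + 1) := fun Z hZ =>
  mem_TKS_iff.2 ⟨0, Z, hZ, (congrElt_zero_mul Z).symm⟩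

theorem congrElt_mul_mem_NsetOdd (hm : 1 ≤ m) {X : GL (Fin 2) (ZMod (p ^ (2 * m + 1)))}
    (hX : X ∈ NsetOdd p (2 * m + 1) ε m) (B) :
    congrElt p m B * X ∈ NsetOdd p (2 * m + 1) ε m := by
  obtain ⟨a, b, c, d, hX⟩ := hX
  obtain ⟨k, rfl⟩ := Nat.exists_eq_add_of_le' hm
  have hv : (congrElt p (k + 1) B * X).val =
      X.val + (p : ZMod (p ^ (2 * (k + 1) + 1))) ^ (k + 1 + 1) • (B * X.val) := by
    simp [add_mul]
  generalize B * X.val = D at hv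
  refine ⟨a + p ^ (k + 1 + 1) * D 0 0, b + p ^ (k + 1) * D 1 0, c + D 0 1 - ε * D 1 0,
    d + D 1 1 - D 0 0, ?_⟩
  rw [hv, hX]
  ext i j
  fin_cases i <;> fin_cases j <;> simp <;> ring

theorem congrElt_mul_mem_NsetOdd_iff (hm : 1 ≤ m) {X : GL (Fin 2) (ZMod (p ^ (2 * m + 1)))} (B) :
    congrElt p m B * X ∈ NsetOdd p (2 * m + 1) ε m ↔ X ∈ NsetOdd p (2 * m + 1) ε m :=
  ⟨fun h => by simpa only [congrElt_neg_mul] using congrElt_mul_mem_NsetOdd hm h (-B),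
    fun h => congrElt_mul_mem_NsetOdd hm h B⟩

/-- The invertible matrices `[[a, εb + p^(m+1)c], [b, a + p^(m+1)d]]` with `(a, b) ∈ U`. -/
def shapeSet (p m ε : ℕ) (U : Set (ZMod (p ^ (2 * m + 1)) × ZMod (p ^ (2 * m + 1)))) :
    Set (GL (Fin 2) (ZMod (p ^ (2 * m + 1)))) :=
  {X | (X.val 0 0, X.val 1 0) ∈ U ∧
    (p : ZMod (p ^ (2 * m + 1))) ^ (m + 1) ∣ X.val 0 1 - ε * X.val 1 0 ∧
    (p : ZMod (p ^ (2 * m + 1))) ^ (m + 1) ∣ X.val 1 1 - X.val 0 0}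

theorem NsetOdd_eq_shapeSet [Fact p.Prime] :
    NsetOdd p (2 * m + 1) ε m = shapeSet p m ε
      ({a | (p : ZMod (p ^ (2 * m + 1))) ∣ a}ᶜ ×ˢ {b | (p : ZMod (p ^ (2 * m + 1))) ∣ b}) := by
  ext X
  constructor
  · rintro ⟨a, b, c, d, hX⟩
    refine ⟨⟨?_, ?_⟩, ?_, ?_⟩
    · simp only [Set.mem_compl_iff, Set.mem_ofPred_eq]
      rintro ⟨e, he⟩
      have hdet : IsUnit X.val.det := (Matrix.isUnit_iff_isUnit_det _).1 X.isUnit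
      refine (isUnit_iff_castHom_ne_zero (by omega) _).1 hdet ?_
      rw [castHom_eq_zero_iff_dvd (show 2 * m + 1 ≠ 0 by omega), Matrix.det_fin_two]
      refine dvd_sub (Dvd.dvd.mul_right ⟨e, he⟩ _) (Dvd.dvd.mul_left ⟨b, ?_⟩ _)
      simp [hX]
    · exact ⟨b, by simp [hX]⟩
    · exact ⟨c, by simp [hX]; ring⟩
    · exact ⟨d, by simp [hX]⟩
  · rintro ⟨⟨-, b, hb⟩, ⟨c, hc⟩, ⟨d, hd⟩⟩
    simp only at hb
    refine ⟨X.val 0 0, b, c, d, ?_⟩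
    rw [← hb, ← hc, ← hd, mul_assoc, mul_left_comm, ← hb]
    nth_rewrite 1 [Matrix.eta_fin_two X.val]
    congr <;> ring

theorem isUnit_det_shape [Fact p.Prime] (hres : ¬ IsSquare (ε : ZMod p))
    {a b u v : ZMod (p ^ (2 * m + 1))}
    (hab : ¬ ((p : ZMod (p ^ (2 * m + 1))) ∣ a ∧ (p : ZMod (p ^ (2 * m + 1))) ∣ b))
    (hu : (p : ZMod (p ^ (2 * m + 1))) ^ (m + 1) ∣ u)
    (hv : (p : ZMod (p ^ (2 * m + 1))) ^ (m + 1) ∣ v) :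
    IsUnit (!![a, ε * b + u; b, a + v] : Matrix _ _ (ZMod (p ^ (2 * m + 1)))).det := by
  have hl : 2 * m + 1 ≠ 0 := by omega
  have hu0 := (castHom_eq_zero_iff_dvd hl u).2 ((dvd_pow_self _ (by omega)).trans hu)
  have hv0 := (castHom_eq_zero_iff_dvd hl v).2 ((dvd_pow_self _ (by omega)).trans hv)
  rw [← castHom_eq_zero_iff_dvd hl, ← castHom_eq_zero_iff_dvd hl] at hab
  rw [isUnit_iff_castHom_ne_zero hl, Matrix.det_fin_two_of, map_sub, map_mul, map_mul, map_add,
    map_add, hu0, hv0, map_mul, map_natCast]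
  intro h
  set x := ZMod.castHom (dvd_pow_self p hl) (ZMod p) a
  set y := ZMod.castHom (dvd_pow_self p hl) (ZMod p) b
  by_cases hy : y = 0
  · simp only [hy, mul_zero, add_zero, sub_zero, mul_self_eq_zero] at h
    exact hab ⟨h, hy⟩
  · exact hres ⟨x / y, by field_simp; linear_combination -h⟩

theorem ncard_shapeSet [Fact p.Prime] (hres : ¬ IsSquare (ε : ZMod p))
    {U : Set (ZMod (p ^ (2 * m + 1)) × ZMod (p ^ (2 * m + 1)))}
    (hU : ∀ x ∈ U, ¬ ((p : ZMod (p ^ (2 * m + 1))) ∣ x.1 ∧ (p : ZMod (p ^ (2 * m + 1))) ∣ x.2)) :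
    (shapeSet p m ε U).ncard = U.ncard *
      {x : ZMod (p ^ (2 * m + 1)) | (p : ZMod (p ^ (2 * m + 1))) ^ (m + 1) ∣ x}.ncard ^ 2 := by
  let I := {x : ZMod (p ^ (2 * m + 1)) | (p : ZMod (p ^ (2 * m + 1))) ^ (m + 1) ∣ x}
  let g : GL (Fin 2) (ZMod (p ^ (2 * m + 1))) →
      (ZMod (p ^ (2 * m + 1)) × ZMod (p ^ (2 * m + 1))) ×
        (ZMod (p ^ (2 * m + 1)) × ZMod (p ^ (2 * m + 1))) := fun X =>
    ((X.val 0 0, X.val 1 0), (X.val 0 1 - ε * X.val 1 0, X.val 1 1 - X.val 0 0))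
  have hg : Function.Injective g := by
    intro X Y h
    simp only [g, Prod.mk.injEq] at h
    obtain ⟨⟨h00, h10⟩, h01, h11⟩ := h
    rw [h10, sub_left_inj] at h01
    rw [h00, sub_left_inj] at h11
    ext i j
    fin_cases i <;> fin_cases j <;> assumption
  have himg : g '' shapeSet p m ε U = U ×ˢ (I ×ˢ I) := by
    ext ⟨⟨a, b⟩, u, v⟩
    constructor
    · rintro ⟨X, ⟨h1, h2, h3⟩, hX⟩
      rw [← hX]
      exact ⟨h1, h2, h3⟩
    · rintro ⟨h1, h2, h3⟩
      have hdet := isUnit_det_shape hres (hU _ h1) h2 h3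
      obtain ⟨X, hX⟩ := (Matrix.isUnit_iff_isUnit_det _).2 hdet
      have hgX : g X = ((a, b), u, v) := by simp [g, hX]
      refine ⟨X, ?_, hgX⟩
      simp only [g, Prod.mk.injEq] at hgX
      obtain ⟨⟨h00, h10⟩, h01, h11⟩ := hgX
      refine ⟨?_, ?_, ?_⟩
      · rw [h00, h10]
        exact h1
      · rw [h01]
        exact h2
      · rw [h11]
        exact h3
  rw [← Set.ncard_image_of_injective _ hg, himg, Set.ncard_prod, Set.ncard_prod, sq]

theorem TKS_eq_shapeSet [Fact p.Prime] (hres : ¬ IsSquare (ε : ZMod p)) :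
    TKS p (2 * m + 1) ε (m + 1) = shapeSet p m ε
      ({a | (p : ZMod (p ^ (2 * m + 1))) ∣ a} ×ˢ {b | (p : ZMod (p ^ (2 * m + 1))) ∣ b})ᶜ := by
  ext X
  constructor
  · intro hX
    obtain ⟨B, Z, ⟨a, b, hZ⟩, h⟩ := mem_TKS_iff.1 hX
    have hv : X.val = !![a, ε * b; b, a] + (p : ZMod (p ^ (2 * m + 1))) ^ (m + 1) • (B * Z.val) := by
      rw [h, ← hZ]
      simp [add_mul]
    refine ⟨?_, ?_, ?_⟩
    · simp only [Set.mem_compl_iff, Set.mem_prod, Set.mem_ofPred_eq]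
      rintro ⟨h0, h1⟩
      have hdet : IsUnit X.val.det := (Matrix.isUnit_iff_isUnit_det _).1 X.isUnit
      refine (isUnit_iff_castHom_ne_zero (by omega) _).1 hdet ?_
      rw [castHom_eq_zero_iff_dvd (show 2 * m + 1 ≠ 0 by omega), Matrix.det_fin_two]
      exact dvd_sub (h0.mul_right _) (h1.mul_left _)
    · exact ⟨(B * Z.val) 0 1 - ε * (B * Z.val) 1 0, by rw [hv]; simp; ring⟩
    · exact ⟨(B * Z.val) 1 1 - (B * Z.val) 0 0, by rw [hv]; simp; ring⟩
  · rintro ⟨h1, ⟨c, hc⟩, ⟨d, hd⟩⟩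
    have hdet := isUnit_det_shape (u := 0) (v := 0) hres (fun h => h1 h) (dvd_zero _) (dvd_zero _)
    obtain ⟨Z, hZ⟩ := (Matrix.isUnit_iff_isUnit_det _).2 hdet
    have hZv : Z.val = !![X.val 0 0, ε * X.val 1 0; X.val 1 0, X.val 0 0] := by
      simp [hZ]
    refine mem_TKS_iff.2 ⟨!![0, c; 0, d] * Z⁻¹.val, Z, ⟨_, _, hZv⟩, ?_⟩
    ext1
    rw [Units.val_mul, val_oneAddSMul, add_mul, one_mul, smul_mul_assoc, Matrix.mul_assoc,
      Units.inv_mul, mul_one, hZv]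
    nth_rewrite 1 [Matrix.eta_fin_two X.val]
    ext i j
    fin_cases i <;> fin_cases j <;> simp [← hc, ← hd]

theorem card_TKS_eq [Fact p.Prime] (hres : ¬ IsSquare (ε : ZMod p)) :
    Nat.card (TKS p (2 * m + 1) ε (m + 1)) = (p + 1) * Nat.card (NsetOdd p (2 * m + 1) ε m) := by
  set D := {a | (p : ZMod (p ^ (2 * m + 1))) ∣ a} with hD
  have hL : ∀ x ∈ (D ×ˢ D)ᶜ, ¬ ((p : ZMod (p ^ (2 * m + 1))) ∣ x.1 ∧
      (p : ZMod (p ^ (2 * m + 1))) ∣ x.2) := fun _ hx h => hx h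
  have hN : ∀ x ∈ Dᶜ ×ˢ D, ¬ ((p : ZMod (p ^ (2 * m + 1))) ∣ x.1 ∧
      (p : ZMod (p ^ (2 * m + 1))) ∣ x.2) :=
    fun _ hx h => hx.1 h.1
  rw [Nat.card_coe_set_eq, Nat.card_coe_set_eq, TKS_eq_shapeSet hres, NsetOdd_eq_shapeSet,
    ← hD, ncard_shapeSet hres hL, ncard_shapeSet hres hN, Set.ncard_prod, ← mul_assoc]
  congr 1
  have hDcard : D.ncard = p ^ (2 * m) := by
    simpa [hD] using ncard_primePow_dvd (p := p) (show 2 * m + 1 = 2 * m + 1 from rfl)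
  have h1 : p ^ (2 * m) + Dᶜ.ncard = p ^ (2 * m) * p := by
    rw [← pow_succ, ← hDcard, Set.ncard_add_ncard_compl, Nat.card_zmod]
  have h2 : p ^ (2 * m) * p ^ (2 * m) + (D ×ˢ D)ᶜ.ncard = p ^ (2 * m) * p * (p ^ (2 * m) * p) := by
    rw [← pow_succ, ← hDcard, ← Set.ncard_prod, Set.ncard_add_ncard_compl, Nat.card_prod,
      Nat.card_zmod]
  rw [hDcard]
  nlinarith

end CongruenceSets

section CharacterSums

variable {p m ε : ℕ} [Fact p.Prime]

theorem sum_indicator_eq_sum_of_shift {H : Set (GL (Fin 2) (ZMod (p ^ (2 * m + 1))))}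
    {F : GL (Fin 2) (ZMod (p ^ (2 * m + 1))) → ℂ}
    {C : GL (Fin 2) (ZMod (p ^ (2 * m + 1))) → Matrix (Fin 2) (Fin 2) (ZMod (p ^ (2 * m + 1)))}
    (hH : ∀ B X, congrElt p m B * X ∈ H ↔ X ∈ H)
    (hF : ∀ B, ∀ X ∈ H, F (congrElt p m B * X) = F X * ZMod.stdAddChar (C X * B).trace) :
    ∑ X, H.indicator F X = ∑ X, (H ∩ {X | C X = 0}).indicator F X := by
  have h1 (B : Matrix (Fin 2) (Fin 2) (ZMod (p ^ (2 * m + 1)))) : ∑ X, H.indicator F X =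
      ∑ X, H.indicator F X * ZMod.stdAddChar (C X * B).trace := by
    rw [← Equiv.sum_comp (Equiv.mulLeft (congrElt p m B)) (H.indicator F)]
    refine Finset.sum_congr rfl fun X _ => ?_
    by_cases h : X ∈ H
    · rw [Equiv.coe_mulLeft, Set.indicator_of_mem ((hH B X).2 h), Set.indicator_of_mem h,
        hF B X h]
    · rw [Equiv.coe_mulLeft, Set.indicator_of_notMem (mt (hH B X).1 h),
        Set.indicator_of_notMem h, zero_mul]
  have hcard : (Fintype.card (Matrix (Fin 2) (Fin 2) (ZMod (p ^ (2 * m + 1)))) : ℂ) ≠ 0 :=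
    Nat.cast_ne_zero.2 Fintype.card_ne_zero
  refine mul_left_cancel₀ hcard ?_
  calc _ = ∑ _B : Matrix (Fin 2) (Fin 2) (ZMod (p ^ (2 * m + 1))), ∑ X, H.indicator F X := by
        simp
    _ = ∑ B : Matrix (Fin 2) (Fin 2) (ZMod (p ^ (2 * m + 1))),
          ∑ X, H.indicator F X * ZMod.stdAddChar (C X * B).trace :=
        Finset.sum_congr rfl fun B _ => h1 B
    _ = _ := by
        rw [Finset.sum_comm, Finset.mul_sum]
        refine Finset.sum_congr rfl fun X _ => ?_
        rw [← Finset.mul_sum, sum_stdAddChar_trace_mul]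
        by_cases h : X ∈ H <;> by_cases h0 : C X = 0 <;> simp [h, h0, mul_comm]

theorem card_mul_sum_inter_Sset {T : Set (GL (Fin 2) (ZMod (p ^ (2 * m + 1))))}
    {F : GL (Fin 2) (ZMod (p ^ (2 * m + 1))) → ℂ}
    (hTL : T ⊆ TKS p (2 * m + 1) ε (m + 1))
    (hT : ∀ B X, congrElt p m B * X ∈ T ↔ X ∈ T)
    (hF : ∀ B, ∀ X ∈ T, F (congrElt p m B * X) = F X) :
    (Nat.card (Matrix (Fin 2) (Fin 2) (ZMod (p ^ (2 * m + 1)))) : ℂ) *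
        ∑ X, (T ∩ Sset p (2 * m + 1) ε).indicator F X =
      {B | congrElt p m B ∈ Sset p (2 * m + 1) ε}.ncard * ∑ X, T.indicator F X := by
  classical
  have h1 (B : Matrix (Fin 2) (Fin 2) (ZMod (p ^ (2 * m + 1)))) :
      ∑ X, (T ∩ Sset p (2 * m + 1) ε).indicator F X =
        ∑ X, (T ∩ Sset p (2 * m + 1) ε).indicator F (congrElt p m B * X) :=
    (Equiv.sum_comp (Equiv.mulLeft (congrElt p m B)) _).symm
  calc _ = ∑ _B : Matrix (Fin 2) (Fin 2) (ZMod (p ^ (2 * m + 1))),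
          ∑ X, (T ∩ Sset p (2 * m + 1) ε).indicator F X := by simp
    _ = ∑ B : Matrix (Fin 2) (Fin 2) (ZMod (p ^ (2 * m + 1))),
          ∑ X, (T ∩ Sset p (2 * m + 1) ε).indicator F (congrElt p m B * X) :=
        Finset.sum_congr rfl fun B _ => h1 B
    _ = _ := by
        rw [Finset.sum_comm, Finset.mul_sum]
        refine Finset.sum_congr rfl fun X _ => ?_
        by_cases hX : X ∈ T
        · obtain ⟨B₀, Z, hZ, hXZ⟩ := mem_TKS_iff.1 (hTL hX)
          have h2 (B) : (T ∩ Sset p (2 * m + 1) ε).indicator F (congrElt p m B * X) =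
              if congrElt p m (B + B₀) ∈ Sset p (2 * m + 1) ε then F X else 0 := by
            have hiff : congrElt p m B * X ∈ Sset p (2 * m + 1) ε ↔
                congrElt p m (B + B₀) ∈ Sset p (2 * m + 1) ε := by
              rw [hXZ, ← mul_assoc, oneAddSMul_mul]
              exact ⟨fun h => by simpa using mul_mem_Sset h (inv_mem_Sset hZ),
                fun h => mul_mem_Sset h hZ⟩
            simp only [Set.indicator_apply, Set.mem_inter_iff, hT, hX, true_and, hiff, hF B X hX]
          simp only [h2]
          have h3 := Equiv.sum_comp (Equiv.addRight B₀)
            (fun B => if congrElt p m B ∈ Sset p (2 * m + 1) ε then F X else 0)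
          simp only [Equiv.coe_addRight] at h3
          refine h3.trans ?_
          rw [Set.indicator_of_mem hX, ← Finset.sum_filter, Finset.sum_const, nsmul_eq_mul,
            ← Set.ncard_coe_finset]
          simp
        · rw [Set.indicator_of_notMem hX, mul_zero]
          refine Finset.sum_eq_zero fun B _ => Set.indicator_of_notMem (fun h => hX ?_) _
          exact (hT B X).1 h.1

theorem congrElt_mem_Sset_iff (B) : congrElt p m B ∈ Sset p (2 * m + 1) ε ↔
    (p : ZMod (p ^ (2 * m + 1))) ^ m ∣ B 0 1 - ε * B 1 0 ∧
      (p : ZMod (p ^ (2 * m + 1))) ^ m ∣ B 1 1 - B 0 0 := by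
  have hl : m + 1 + m = 2 * m + 1 := by ring
  rw [← primePow_mul_eq_zero_iff hl, ← primePow_mul_eq_zero_iff hl]
  constructor
  · rintro ⟨a, b, h⟩
    rw [val_oneAddSMul] at h
    have h00 := congrFun (congrFun h 0) 0
    have h01 := congrFun (congrFun h 0) 1
    have h10 := congrFun (congrFun h 1) 0
    have h11 := congrFun (congrFun h 1) 1
    simp at h00 h01 h10 h11
    constructor
    · linear_combination h01 - ε * h10
    · linear_combination h11 - h00
  · rintro ⟨h1, h2⟩
    refine ⟨1 + (p : ZMod (p ^ (2 * m + 1))) ^ (m + 1) * B 0 0,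
      (p : ZMod (p ^ (2 * m + 1))) ^ (m + 1) * B 1 0, ?_⟩
    rw [val_oneAddSMul]
    ext i j
    fin_cases i <;> fin_cases j <;> simp
    · linear_combination h1
    · linear_combination h2

theorem ncard_congrElt_mem_Sset :
    {B | congrElt p m B ∈ Sset p (2 * m + 1) ε}.ncard =
      (p ^ (2 * m + 1)) ^ 2 * (p ^ (m + 1)) ^ 2 := by
  let J := {x : ZMod (p ^ (2 * m + 1)) | (p : ZMod (p ^ (2 * m + 1))) ^ m ∣ x}
  let g : Matrix (Fin 2) (Fin 2) (ZMod (p ^ (2 * m + 1))) →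
      (ZMod (p ^ (2 * m + 1)) × ZMod (p ^ (2 * m + 1))) ×
        (ZMod (p ^ (2 * m + 1)) × ZMod (p ^ (2 * m + 1))) := fun X =>
    ((X 0 0, X 1 0), (X 0 1 - ε * X 1 0, X 1 1 - X 0 0))
  have hg : Function.Injective g := by
    intro X Y h
    simp only [g, Prod.mk.injEq] at h
    obtain ⟨⟨h00, h10⟩, h01, h11⟩ := h
    rw [h10, sub_left_inj] at h01
    rw [h00, sub_left_inj] at h11
    ext i j
    fin_cases i <;> fin_cases j <;> assumption
  have himg : g '' {B | congrElt p m B ∈ Sset p (2 * m + 1) ε} = Set.univ ×ˢ (J ×ˢ J) := by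
    ext ⟨⟨a, b⟩, u, v⟩
    simp only [congrElt_mem_Sset_iff]
    constructor
    · rintro ⟨X, ⟨h1, h2⟩, hX⟩
      rw [← hX]
      exact ⟨trivial, h1, h2⟩
    · rintro ⟨-, h1, h2⟩
      have hgX : g !![a, ε * b + u; b, a + v] = ((a, b), u, v) := by simp [g]
      refine ⟨_, ?_, hgX⟩
      simp only [g, Prod.mk.injEq] at hgX
      refine ⟨?_, ?_⟩
      · rw [hgX.2.1]
        exact h1
      · rw [hgX.2.2]
        exact h2
  have hJ : J.ncard = p ^ (m + 1) := ncard_primePow_dvd (by ring)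
  rw [← Set.ncard_image_of_injective _ hg, himg, Set.ncard_prod, Set.ncard_prod, Set.ncard_univ,
    Nat.card_prod, Nat.card_zmod, hJ, sq, sq]

theorem sum_eq_primePow_mul_sum_inter_Sset {T : Set (GL (Fin 2) (ZMod (p ^ (2 * m + 1))))}
    {F : GL (Fin 2) (ZMod (p ^ (2 * m + 1))) → ℂ}
    (hTL : T ⊆ TKS p (2 * m + 1) ε (m + 1))
    (hT : ∀ B X, congrElt p m B * X ∈ T ↔ X ∈ T)
    (hF : ∀ B, ∀ X ∈ T, F (congrElt p m B * X) = F X) :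
    ∑ X, T.indicator F X = (p : ℂ) ^ (2 * m) * ∑ X, (T ∩ Sset p (2 * m + 1) ε).indicator F X := by
  have hp : (p : ℂ) ≠ 0 := Nat.cast_ne_zero.2 (Fact.out : p.Prime).ne_zero
  have h := card_mul_sum_inter_Sset hTL hT hF
  have hcard : Nat.card (Matrix (Fin 2) (Fin 2) (ZMod (p ^ (2 * m + 1)))) =
      (p ^ (2 * m + 1)) ^ 4 := by
    change Nat.card (Fin 2 → Fin 2 → ZMod (p ^ (2 * m + 1))) = _
    rw [Nat.card_fun, Nat.card_fun, Nat.card_zmod, Nat.card_fin, ← pow_mul]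
  rw [ncard_congrElt_mem_Sset, hcard] at h
  push_cast at h
  refine mul_left_cancel₀ (pow_ne_zero (6 * m + 4) hp) ?_
  rw [← mul_assoc]
  ring_nf at h ⊢
  exact h.symm

end CharacterSums

section TwistedSum

variable {p m α ε : ℕ}

/-- The summand `μ(det Y) e(Tr Y) φ(Y)` of the Gauss sum. -/
def gaussSummand (p m : ℕ) (r : ℤ) (μ : ZMod (p ^ (2 * m + 1)) → ℂ)
    (φ : GL (Fin 2) (ZMod (p ^ (2 * m + 1))) → ℂ) (Y : GL (Fin 2) (ZMod (p ^ (2 * m + 1)))) : ℂ :=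
  μ Y.val.det * aChar (p ^ (2 * m + 1)) r (Matrix.trace Y.val) * φ Y

/-- The matrix `p^(m+1)(α + A₀ + rY)` which governs the change of the summand of the Gauss sum
under translation by `K_{m+1}`. -/
def shiftMatrix (p m α ε : ℕ) (r : ℤ) (Y : GL (Fin 2) (ZMod (p ^ (2 * m + 1)))) :
    Matrix (Fin 2) (Fin 2) (ZMod (p ^ (2 * m + 1))) :=
  (p : ZMod (p ^ (2 * m + 1))) ^ (m + 1) •
    (!![(α : ZMod (p ^ (2 * m + 1))), ε; 1, α] + (r : ZMod (p ^ (2 * m + 1))) • Y.val)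

theorem shiftMatrix_congrElt_mul {r : ℤ} (B) (Y : GL (Fin 2) (ZMod (p ^ (2 * m + 1)))) :
    shiftMatrix p m α ε r (congrElt p m B * Y) = shiftMatrix p m α ε r Y := by
  rw [shiftMatrix, shiftMatrix, Units.val_mul, val_oneAddSMul, add_mul, one_mul, smul_mul_assoc,
    smul_add, smul_add, smul_add, smul_comm, smul_comm _ (r : ZMod (p ^ (2 * m + 1))) (_ • _),
    smul_smul _ _ (B * _), primePow_succ_mul_self, zero_smul, smul_zero, add_zero,
    smul_add, smul_comm (r : ZMod (p ^ (2 * m + 1))) ((p : ZMod (p ^ (2 * m + 1))) ^ (m + 1))]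

variable [Fact p.Prime]

theorem map_one_add_primePow_mul {μ : ZMod (p ^ (2 * m + 1)) → ℂ}
    (hμmul : ∀ x y, IsUnit x → IsUnit y → μ (x * y) = μ x * μ y)
    (hμne : ∀ x, IsUnit x → μ x ≠ 0)
    (hμ : μ (1 + (p : ZMod (p ^ (2 * m + 1))) ^ (m + 1)) =
      aChar (p ^ (2 * m + 1)) 1
        ((p : ZMod (p ^ (2 * m + 1))) ^ (m + 1) * (α : ZMod (p ^ (2 * m + 1)))))
    (t : ZMod (p ^ (2 * m + 1))) :
    μ (1 + (p : ZMod (p ^ (2 * m + 1))) ^ (m + 1) * t) =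
      ZMod.stdAddChar ((p : ZMod (p ^ (2 * m + 1))) ^ (m + 1) *
        ((α : ZMod (p ^ (2 * m + 1))) * t)) := by
  set P := (p : ZMod (p ^ (2 * m + 1))) ^ (m + 1)
  have hP : P * P = 0 := primePow_succ_mul_self p m
  have hu : IsUnit (1 + P) := .of_mul_eq_one (1 - P) (by linear_combination -hP)
  have hμ1 : μ 1 = 1 := by
    have h := hμmul 1 1 isUnit_one isUnit_one
    rw [mul_one] at h
    exact (mul_eq_left₀ (hμne 1 isUnit_one)).1 h.symm
  have hpow (n : ℕ) : μ ((1 + P) ^ n) = μ (1 + P) ^ n := by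
    induction n with
    | zero => simpa using hμ1
    | succ n ih => rw [pow_succ, hμmul _ _ (hu.pow n) hu, ih, pow_succ (μ _)]
  obtain ⟨n, rfl⟩ := ZMod.natCast_zmod_surjective t
  rw [← one_add_pow_of_sq_zero hP, hpow, hμ, aChar_eq_stdAddChar, ← AddChar.map_nsmul_eq_pow]
  congr 1
  rw [nsmul_eq_mul]
  push_cast
  ring

theorem gaussSummand_congrElt_mul {r : ℤ} {μ : ZMod (p ^ (2 * m + 1)) → ℂ}
    {φ : GL (Fin 2) (ZMod (p ^ (2 * m + 1))) → ℂ}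
    (hμmul : ∀ x y, IsUnit x → IsUnit y → μ (x * y) = μ x * μ y)
    (hμne : ∀ x, IsUnit x → μ x ≠ 0)
    (hμ : μ (1 + (p : ZMod (p ^ (2 * m + 1))) ^ (m + 1)) =
      aChar (p ^ (2 * m + 1)) 1
        ((p : ZMod (p ^ (2 * m + 1))) ^ (m + 1) * (α : ZMod (p ^ (2 * m + 1)))))
    (hφmul : ∀ X Y, X ∈ TKS p (2 * m + 1) ε (m + 1) → Y ∈ TKS p (2 * m + 1) ε (m + 1) →
      φ (X * Y) = φ X * φ Y)
    (hφK : ∀ X ∈ Kset p (2 * m + 1) (m + 1), φ X = phiA p (2 * m + 1) !![0, ε; 1, 0] X)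
    (B) (Y) (hY : Y ∈ TKS p (2 * m + 1) ε (m + 1)) :
    gaussSummand p m r μ φ (congrElt p m B * Y) =
      gaussSummand p m r μ φ Y * ZMod.stdAddChar (shiftMatrix p m α ε r Y * B).trace := by
  have hunit (X : GL (Fin 2) (ZMod (p ^ (2 * m + 1)))) : IsUnit X.val.det :=
    (Matrix.isUnit_iff_isUnit_det _).1 X.isUnit
  have htr : (congrElt p m B * Y).val.trace =
      Y.val.trace + (p : ZMod (p ^ (2 * m + 1))) ^ (m + 1) * (B * Y.val).trace := by
    simp [add_mul]
  rw [gaussSummand, gaussSummand, hφmul _ _ (congrElt_mem_TKS B) hY,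
    hφK _ (mem_Kset_succ_iff.2 ⟨B, rfl⟩), phiA, htr, Units.val_mul, Matrix.det_mul,
    hμmul _ _ (hunit _) (hunit _), det_oneAddSMul, map_one_add_primePow_mul hμmul hμne hμ]
  simp only [aChar_eq_stdAddChar, mul_add, AddChar.map_add_eq_mul]
  have hsplit : (shiftMatrix p m α ε r Y * B).trace =
      (p : ZMod (p ^ (2 * m + 1))) ^ (m + 1) * (α * B.trace) +
        (r * ((p : ZMod (p ^ (2 * m + 1))) ^ (m + 1) * (B * Y.val).trace) +
        ((1 : ℤ) : ZMod (p ^ (2 * m + 1))) * (!![0, (ε : ZMod (p ^ (2 * m + 1))); 1, 0] *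
          ((congrElt p m B).val - 1)).trace) := by
    rw [shiftMatrix, val_oneAddSMul, add_sub_cancel_left]
    simp only [Matrix.trace_fin_two, Matrix.mul_apply, Fin.sum_univ_two]
    simp
    ring
  rw [hsplit, AddChar.map_add_eq_mul, AddChar.map_add_eq_mul]
  ring

theorem image_mul_Kset_inter_Sset_eq {r : ℤ} (hpr : ¬ (p : ℤ) ∣ r)
    {M : GL (Fin 2) (ZMod (p ^ (2 * m + 1)))}
    (hM : M.val = !![-(α : ZMod (p ^ (2 * m + 1))) * (r : ZMod (p ^ (2 * m + 1)))⁻¹,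
                     -(ε : ZMod (p ^ (2 * m + 1))) * (r : ZMod (p ^ (2 * m + 1)))⁻¹;
                     -(r : ZMod (p ^ (2 * m + 1)))⁻¹,
                     -(α : ZMod (p ^ (2 * m + 1))) * (r : ZMod (p ^ (2 * m + 1)))⁻¹]) :
    (fun Z => Z * M) '' (Kset p (2 * m + 1) m ∩ Sset p (2 * m + 1) ε) =
      {Y | shiftMatrix p m α ε r Y = 0} ∩ Sset p (2 * m + 1) ε := by
  have hrr := isUnit_intCast_of_not_dvd (l := 2 * m + 1) hpr
  have hinv : (r : ZMod (p ^ (2 * m + 1))) * (r : ZMod (p ^ (2 * m + 1)))⁻¹ = 1 :=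
    ZMod.mul_inv_of_unit _ hrr
  have hMS : M ∈ Sset p (2 * m + 1) ε :=
    ⟨-(α : ZMod (p ^ (2 * m + 1))) * (r : ZMod (p ^ (2 * m + 1)))⁻¹,
      -(r : ZMod (p ^ (2 * m + 1)))⁻¹, by simpa only [mul_neg, neg_mul] using hM⟩
  have hrM : !![(α : ZMod (p ^ (2 * m + 1))), ε; 1, α] =
      -((r : ZMod (p ^ (2 * m + 1))) • M.val) := by
    rw [hM]
    ext i j
    fin_cases i <;> fin_cases j <;> simp
    · linear_combination -(α : ZMod (p ^ (2 * m + 1))) * hinv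
    · linear_combination -(ε : ZMod (p ^ (2 * m + 1))) * hinv
    · linear_combination -hinv
    · linear_combination -(α : ZMod (p ^ (2 * m + 1))) * hinv
  have hshift (Y : GL (Fin 2) (ZMod (p ^ (2 * m + 1)))) : shiftMatrix p m α ε r Y = 0 ↔
      (p : ZMod (p ^ (2 * m + 1))) ^ (m + 1) • (Y.val - M.val) = 0 := by
    rw [shiftMatrix, hrM, neg_add_eq_sub, ← smul_sub, smul_comm, hrr.smul_eq_zero]
  have hdvd (A : Matrix (Fin 2) (Fin 2) (ZMod (p ^ (2 * m + 1)))) :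
      (p : ZMod (p ^ (2 * m + 1))) ^ (m + 1) • A = 0 ↔
        ∃ B, A = (p : ZMod (p ^ (2 * m + 1))) ^ m • B := by
    have hl : m + 1 + m = 2 * m + 1 := by ring
    constructor
    · intro h
      have h' (i j) : (p : ZMod (p ^ (2 * m + 1))) ^ m ∣ A i j :=
        (primePow_mul_eq_zero_iff hl _).1 (by simpa using congrFun (congrFun h i) j)
      choose B hB using h'
      exact ⟨Matrix.of B, by ext i j; simp [hB i j]⟩
    · rintro ⟨B, rfl⟩
      ext i j
      simpa using (primePow_mul_eq_zero_iff hl _).2 (Dvd.intro (B i j) rfl)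
  ext Y
  simp only [Set.mem_inter_iff, Set.mem_ofPred_eq, hshift, hdvd, Set.mem_image]
  constructor
  · rintro ⟨Z, ⟨⟨B, hB⟩, hZ⟩, rfl⟩
    refine ⟨⟨B * M.val, ?_⟩, mul_mem_Sset hZ hMS⟩
    rw [Units.val_mul, hB, add_mul, one_mul, smul_mul_assoc, add_sub_cancel_left]
  · rintro ⟨⟨B, hB⟩, hY⟩
    refine ⟨Y * M⁻¹, ⟨⟨B * M⁻¹.val, ?_⟩, mul_mem_Sset hY (inv_mem_Sset hMS)⟩,
      inv_mul_cancel_right _ _⟩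
    rw [Units.val_mul, ← smul_mul_assoc, ← hB, sub_mul, Units.mul_inv, add_sub_cancel]

theorem shiftMatrix_ne_zero_of_mem_NsetOdd (hm : 1 ≤ m) {r : ℤ}
    {Y : GL (Fin 2) (ZMod (p ^ (2 * m + 1)))} (hY : Y ∈ NsetOdd p (2 * m + 1) ε m) :
    shiftMatrix p m α ε r Y ≠ 0 := by
  obtain ⟨a, b, c, d, hY⟩ := hY
  intro h
  have h10 := congrFun (congrFun h 1) 0
  simp only [shiftMatrix, hY] at h10
  have h1 : (p : ZMod (p ^ (2 * m + 1))) ^ (m + 1) * (1 + r * (p * b)) = 0 := by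
    simpa using h10
  rw [primePow_mul_eq_zero_iff (show m + 1 + m = 2 * m + 1 by ring)] at h1
  have h2 := (castHom_eq_zero_iff_dvd (show 2 * m + 1 ≠ 0 by omega) _).2
    ((dvd_pow_self _ (by omega)).trans h1)
  rw [map_add, map_one, map_mul, map_mul, map_natCast, CharP.cast_eq_zero, zero_mul, mul_zero,
    add_zero] at h2
  exact one_ne_zero h2

theorem NsetOdd_subset_TKS (hres : ¬ IsSquare (ε : ZMod p)) :
    NsetOdd p (2 * m + 1) ε m ⊆ TKS p (2 * m + 1) ε (m + 1) := by
  rw [TKS_eq_shapeSet hres, NsetOdd_eq_shapeSet]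
  exact fun X hX => ⟨fun h => hX.1.1 h.1, hX.2⟩

end TwistedSum

/-- Theorem 3.5(2): for `l = 2m+1` odd, `p ∤ r`, and
`χ_φ = (μ∘det)·((1/p)·Ind_{N_{m+1}}^{G_l}(φ|_{N_{m+1}}) − Ind_{L}^{G_l} φ)`, with
`M = [[−αr⁻¹, −εr⁻¹],[−r⁻¹, −αr⁻¹]] ∈ S` one has
`τ_l(χ_φ) = −p^l · χ_φ(I) · Σ_{Y ∈ (K_m∩S)·M} μ(det Y)·e(Tr Y)·φ(Y)`. -/
theorem gauss_sum_X2_odd (p m : ℕ) [Fact p.Prime] (hp : Odd p) (hm : 1 ≤ m)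
    (r : ℤ) (hr : ¬ ((p : ℤ) ^ (2 * m + 1) ∣ r)) (hpr : ¬ ((p : ℤ) ∣ r))
    (α ε : ℕ) (hα : α < p ^ m) (hε : ε < p ^ m) (hres : ¬ IsSquare (ε : ZMod p))
    (μ : ZMod (p ^ (2 * m + 1)) → ℂ)
    (hμmul : ∀ x y : ZMod (p ^ (2 * m + 1)), IsUnit x → IsUnit y → μ (x * y) = μ x * μ y)
    (hμne : ∀ x : ZMod (p ^ (2 * m + 1)), IsUnit x → μ x ≠ 0)
    (hμ : μ (1 + (p : ZMod (p ^ (2 * m + 1))) ^ (m + 1)) =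
      aChar (p ^ (2 * m + 1)) 1
        ((p : ZMod (p ^ (2 * m + 1))) ^ (m + 1) * (α : ZMod (p ^ (2 * m + 1)))))
    (φ : GL (Fin 2) (ZMod (p ^ (2 * m + 1))) → ℂ)
    (hφmul : ∀ X Y : GL (Fin 2) (ZMod (p ^ (2 * m + 1))),
      X ∈ TKS p (2 * m + 1) ε (m + 1) → Y ∈ TKS p (2 * m + 1) ε (m + 1) →
        φ (X * Y) = φ X * φ Y)
    (hφne : ∀ X ∈ TKS p (2 * m + 1) ε (m + 1), φ X ≠ 0)
    (hφK : ∀ X ∈ Kset p (2 * m + 1) (m + 1),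
      φ X = phiA p (2 * m + 1)
        !![(0 : ZMod (p ^ (2 * m + 1))), (ε : ZMod (p ^ (2 * m + 1))); 1, 0] X)
    (M : GL (Fin 2) (ZMod (p ^ (2 * m + 1))))
    (hM : M.val = !![-(α : ZMod (p ^ (2 * m + 1))) * (r : ZMod (p ^ (2 * m + 1)))⁻¹,
                     -(ε : ZMod (p ^ (2 * m + 1))) * (r : ZMod (p ^ (2 * m + 1)))⁻¹;
                     -(r : ZMod (p ^ (2 * m + 1)))⁻¹,
                     -(α : ZMod (p ^ (2 * m + 1))) * (r : ZMod (p ^ (2 * m + 1)))⁻¹]) :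
    tauGL (p ^ (2 * m + 1)) r (fun X =>
        μ X.val.det *
          ((1 / (p : ℂ)) *
              indC (p ^ (2 * m + 1)) (NsetOdd p (2 * m + 1) ε m) Set.univ φ X -
            indC (p ^ (2 * m + 1)) (TKS p (2 * m + 1) ε (m + 1)) Set.univ φ X))
      = -(p : ℂ) ^ (2 * m + 1) *
          (μ (1 : GL (Fin 2) (ZMod (p ^ (2 * m + 1)))).val.det *
            ((1 / (p : ℂ)) *
                indC (p ^ (2 * m + 1)) (NsetOdd p (2 * m + 1) ε m) Set.univ φ 1 -
              indC (p ^ (2 * m + 1)) (TKS p (2 * m + 1) ε (m + 1)) Set.univ φ 1)) *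
          ∑ Y : GL (Fin 2) (ZMod (p ^ (2 * m + 1))),
            ((fun Z => Z * M) '' (Kset p (2 * m + 1) m ∩ Sset p (2 * m + 1) ε)).indicator
              (fun Y => μ Y.val.det * aChar (p ^ (2 * m + 1)) r (Matrix.trace Y.val) * φ Y)
              Y := by
  have hp0 : (p : ℂ) ≠ 0 := Nat.cast_ne_zero.2 (Fact.out : p.Prime).ne_zero
  have h1L : 1 ∈ TKS p (2 * m + 1) ε (m + 1) := Sset_subset_TKS one_mem_Sset
  have h1N : 1 ∈ NsetOdd p (2 * m + 1) ε m := by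
    refine ⟨1, 0, 0, 0, ?_⟩
    simp [Matrix.one_fin_two]
  have hμ1 : μ 1 = 1 := by
    have h := hμmul 1 1 isUnit_one isUnit_one
    rw [mul_one] at h
    exact (mul_eq_left₀ (hμne 1 isUnit_one)).1 h.symm
  have hφ1 : φ 1 = 1 := by
    have h := hφmul 1 1 h1L h1L
    rw [mul_one] at h
    exact (mul_eq_left₀ (hφne 1 h1L)).1 h.symm
  have hcard : (Nat.card (TKS p (2 * m + 1) ε (m + 1)) : ℂ) =
      (p + 1) * Nat.card (NsetOdd p (2 * m + 1) ε m) := by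
    exact_mod_cast card_TKS_eq hres
  have hcardN : (Nat.card (NsetOdd p (2 * m + 1) ε m) : ℂ) ≠ 0 := by
    have : Nonempty (NsetOdd p (2 * m + 1) ε m) := ⟨1, h1N⟩
    exact Nat.cast_ne_zero.2 Nat.card_pos.ne'
  have hp1 : (p : ℂ) + 1 ≠ 0 := Nat.cast_add_one_ne_zero p
  have hshift := gaussSummand_congrElt_mul (r := r) hμmul hμne hμ hφmul hφK
  have hclass (x y : GL (Fin 2) (ZMod (p ^ (2 * m + 1)))) :
      μ (y * x * y⁻¹).val.det * aChar (p ^ (2 * m + 1)) r (Matrix.trace (y * x * y⁻¹).val) =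
        μ x.val.det * aChar (p ^ (2 * m + 1)) r (Matrix.trace x.val) := by
    rw [Units.val_mul, Units.val_mul, Matrix.trace_units_conj, Matrix.det_units_conj]
  have hN := sum_classFunction_mul_indC (NsetOdd p (2 * m + 1) ε m)
    (fun X => μ X.val.det * aChar (p ^ (2 * m + 1)) r (Matrix.trace X.val)) φ hclass
  have hL := sum_classFunction_mul_indC (TKS p (2 * m + 1) ε (m + 1))
    (fun X => μ X.val.det * aChar (p ^ (2 * m + 1)) r (Matrix.trace X.val)) φ hclass
  have hN0 : ∑ Y, (NsetOdd p (2 * m + 1) ε m).indicator (gaussSummand p m r μ φ) Y = 0 := by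
    rw [sum_indicator_eq_sum_of_shift (fun B X => congrElt_mul_mem_NsetOdd_iff hm B)
      fun B X hX => hshift B X (NsetOdd_subset_TKS hres hX)]
    exact Finset.sum_eq_zero fun X _ => Set.indicator_of_notMem
      (fun h => shiftMatrix_ne_zero_of_mem_NsetOdd hm h.1 h.2) _
  have hL0 : ∑ Y, (TKS p (2 * m + 1) ε (m + 1)).indicator (gaussSummand p m r μ φ) Y =
      (p : ℂ) ^ (2 * m) *
        ∑ Y, ((fun Z => Z * M) '' (Kset p (2 * m + 1) m ∩ Sset p (2 * m + 1) ε)).indicator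
          (gaussSummand p m r μ φ) Y := by
    rw [sum_indicator_eq_sum_of_shift (fun B X => congrElt_mul_mem_TKS_iff B) hshift,
      sum_eq_primePow_mul_sum_inter_Sset Set.inter_subset_left, image_mul_Kset_inter_Sset_eq hpr hM,
      Set.inter_assoc, Set.inter_eq_right.2 (Set.inter_subset_right.trans Sset_subset_TKS)]
    · intro B X
      simp only [Set.mem_inter_iff, congrElt_mul_mem_TKS_iff, Set.mem_ofPred_eq,
        shiftMatrix_congrElt_mul]
    · rintro B X ⟨hX, hX0⟩
      rw [hshift B X hX, show shiftMatrix p m α ε r X = 0 from hX0, zero_mul, Matrix.trace_zero,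
        AddChar.map_zero_eq_one, mul_one]
  unfold gaussSummand at hN0 hL0
  rw [hN0, mul_zero] at hN
  rw [hL0] at hL
  rw [indC_one h1N, indC_one h1L, hφ1, Units.val_one, Matrix.det_one, hμ1, hcard]
  rw [hcard] at hL
  have hsplit (a b c d : ℂ) : a * (1 / (p : ℂ) * b - c) * d =
      1 / (p : ℂ) * (a * d * b) - a * d * c := by ring
  simp only [tauGL, hsplit, Finset.sum_sub_distrib]
  rw [← Finset.mul_sum, hN, hL]
  field_simp
  ring
end
end
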